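/- (Poincaré–Faber–Szegő inequality.) Let n ≥ 3 and let Ω ⊂ ℝⁿ be a bounded open set with smooth boundary. Then (vol(Ω)/vol(Bⁿ))^{(n−2)/n} ≤ Cap(Ω), where vol denotes Lebesgue measure and Bⁿ is the unit ball of ℝⁿ. -/

import Mathlib

open MeasureTheory Metric Filter Asymptotics
open scoped Topology ENNReal

noncomputable section

abbrev Euc (n : ℕ) : Type := EuclideanSpace ℝ (Fin n)

/-- The surface area `ω_{n-1}` of the unit sphere in `ℝⁿ`, i.e. `n` times the volume of the
unit ball. -/
def sphereArea (n : ℕ) : ℝ := n * (volume (ball (0 : Euc n) 1)).toReal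

/-- A function is harmonic on a set if it is twice differentiable at each point of the set and the
trace of its second derivative (the Laplacian) vanishes there. -/
def IsHarmonicOn {n : ℕ} (u : Euc n → ℝ) (s : Set (Euc n)) : Prop :=
  ∀ x ∈ s, ContDiffAt ℝ 2 u x ∧
    ∑ i : Fin n, iteratedFDeriv ℝ 2 u x
      ![EuclideanSpace.single i 1, EuclideanSpace.single i 1] = 0

/-- A set has smooth boundary if near every boundary point it is the sublevel set of a smooth
function with nonvanishing differential. -/
def HasSmoothBoundary {n : ℕ} (Ω : Set (Euc n)) : Prop :=
  ∀ x ∈ frontier Ω, ∃ (f : Euc n → ℝ) (U : Set (Euc n)),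
    IsOpen U ∧ x ∈ U ∧ ContDiff ℝ (⊤ : ℕ∞) f ∧ (∀ y ∈ U, fderiv ℝ f y ≠ 0) ∧
    Ω ∩ U = {y | f y < 0} ∩ U

/-- The electrostatic capacity of `Ω ⊂ ℝⁿ`. -/
def capacity (n : ℕ) (Ω : Set (Euc n)) : ℝ :=
  sInf { c : ℝ | ∃ w : Euc n → ℝ, ContDiff ℝ (⊤ : ℕ∞) w ∧ HasCompactSupport w ∧
    (∀ x ∈ Ω, w x = 1) ∧
    c = (1 / (((n : ℝ) - 2) * sphereArea n)) * ∫ x, ‖gradient w x‖ ^ 2 }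

/-- `(Ω, u)` is a regular solution of the exterior capacitary problem. -/
structure IsRegularSolution (n : ℕ) (Ω : Set (Euc n)) (u : Euc n → ℝ) : Prop where
  dim_ge : 3 ≤ n
  bounded : Bornology.IsBounded Ω
  isOpen : IsOpen Ω
  zero_mem : (0 : Euc n) ∈ Ω
  smoothBoundary : HasSmoothBoundary Ω
  compl_connected : IsConnected Ωᶜ
  smooth : ContDiffOn ℝ (⊤ : ℕ∞) u Ωᶜ
  harmonic : IsHarmonicOn u (closure Ω)ᶜ
  boundary_eq_one : ∀ x ∈ frontier Ω, u x = 1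
  tendsto_zero : Tendsto u (cocompact (Euc n)) (𝓝 0)

theorem volume_add_volume_le_of_isCompact {K L C : Set ℝ} (hK : IsCompact K) (hL : IsCompact L)
    (hK0 : K.Nonempty) (hL0 : L.Nonempty) (hC : ∀ x ∈ K, ∀ y ∈ L, x + y ∈ C) :
    volume K + volume L ≤ volume C := by
  obtain ⟨m, hm, hmax⟩ := hK.exists_isGreatest hK0
  obtain ⟨l, hl, hmin⟩ := hL.exists_isLeast hL0
  have h1 : volume ((fun x => x + -l) ⁻¹' K) = volume K := measure_preimage_add_right _ _ _
  have h2 : volume ((fun x => x + -m) ⁻¹' L) = volume L := measure_preimage_add_right _ _ _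
  rw [← h1, ← h2, ← measure_union₀]
  · refine measure_mono ?_
    rintro x (hx | hx)
    · simpa using hC _ hx _ hl
    · simpa using hC _ hm _ hx
  · exact ((hL.measurableSet).preimage (by fun_prop)).nullMeasurableSet
  · refine measure_mono_null (t := {m + l}) ?_ (by simp)
    rintro x ⟨hx, hy⟩
    have h3 := hmax hx
    have h4 := hmin hy
    simp only [Set.mem_singleton_iff]
    linarith

theorem volume_add_volume_le {A B C : Set ℝ} (hA : MeasurableSet A) (hB : MeasurableSet B)
    (hA0 : A.Nonempty) (hB0 : B.Nonempty) (hC : ∀ x ∈ A, ∀ y ∈ B, x + y ∈ C) :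
    volume A + volume B ≤ volume C := by
  obtain ⟨a, ha⟩ := hA0
  obtain ⟨b, hb⟩ := hB0
  rw [hA.measure_eq_iSup_isCompact, hB.measure_eq_iSup_isCompact]
  simp only [iSup_and']
  refine ENNReal.biSup_add_biSup_le' (p := fun K => K ⊆ A ∧ IsCompact K)
    (q := fun K => K ⊆ B ∧ IsCompact K) ⟨∅, by simp⟩ ⟨∅, by simp⟩ ?_
  rintro K ⟨hKA, hK⟩ L ⟨hLB, hL⟩
  refine le_trans (add_le_add (measure_mono (Set.subset_insert a K))
    (measure_mono (Set.subset_insert b L))) ?_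
  refine volume_add_volume_le_of_isCompact (hK.insert a) (hL.insert b) (by simp) (by simp) ?_
  intro x hx y hy
  exact hC x (Set.insert_subset ha hKA hx) y (Set.insert_subset hb hLB hy)

theorem weighted_volume_add_le {A B C : Set ℝ} {p q : ℝ} (hp : 0 < p) (hq : 0 < q)
    (hA : MeasurableSet A) (hB : MeasurableSet B)
    (hA0 : A.Nonempty) (hB0 : B.Nonempty) (hC : ∀ x ∈ A, ∀ y ∈ B, p * x + q * y ∈ C) :
    ENNReal.ofReal p * volume A + ENNReal.ofReal q * volume B ≤ volume C := by
  have h1 := Measure.addHaar_smul volume p A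
  have h2 := Measure.addHaar_smul volume q B
  simp only [Module.finrank_self, pow_one, abs_of_pos hp, abs_of_pos hq] at h1 h2
  rw [← h1, ← h2]
  refine volume_add_volume_le (hA.const_smul₀ p) (hB.const_smul₀ q) (hA0.image _) (hB0.image _) ?_
  rintro _ ⟨x, hx, rfl⟩ _ ⟨y, hy, rfl⟩
  exact hC x hx y hy

theorem lintegral_eq_setLIntegral_volume_lt {f : ℝ → ℝ≥0∞} (hf : Measurable f)
    (h1 : ∀ x, f x ≤ 1) :
    ∫⁻ x, f x = ∫⁻ t in Set.Ioo (0 : ℝ) 1, volume {x | ENNReal.ofReal t < f x} := by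
  have hfin : ∀ x, f x ≠ ∞ := fun x => ne_top_of_le_ne_top (by simp) (h1 x)
  have h := lintegral_eq_lintegral_meas_lt volume (f := fun x => (f x).toReal)
    (Eventually.of_forall fun x => ENNReal.toReal_nonneg) hf.ennreal_toReal.aemeasurable
  simp only [ENNReal.ofReal_toReal (hfin _)] at h
  have hset : ∀ t ∈ Set.Ioi (0 : ℝ), volume {x | t < (f x).toReal}
      = (Set.Iio (1 : ℝ)).indicator (fun t => volume {x | ENNReal.ofReal t < f x}) t := by
    intro t ht
    have h2 : {x | t < (f x).toReal} = {x | ENNReal.ofReal t < f x} := by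
      ext x
      exact (ENNReal.ofReal_lt_iff_lt_toReal (le_of_lt ht) (hfin x)).symm
    by_cases h3 : t < 1
    · rw [Set.indicator_of_mem (by exact h3), h2]
    · rw [Set.indicator_of_notMem (by exact h3), h2]
      convert measure_empty (μ := (volume : Measure ℝ))
      ext x
      simp only [Set.mem_ofPred_eq, Set.mem_empty_iff_false, iff_false, not_lt]
      refine (h1 x).trans ?_
      rw [← ENNReal.ofReal_one]
      exact ENNReal.ofReal_le_ofReal (not_lt.mp h3)
  rw [h, setLIntegral_congr_fun measurableSet_Ioi hset, setLIntegral_indicator measurableSet_Iio,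
    Set.inter_comm, Set.Ioi_inter_Iio]

theorem ENNReal.rpow_mul_rpow_le_weighted_add {p q : ℝ} (hp : 0 < p) (hq : 0 < q)
    (hpq : p + q = 1) (a b : ℝ≥0∞) :
    a ^ p * b ^ q ≤ ENNReal.ofReal p * a + ENNReal.ofReal q * b := by
  have hc : (1 / p).HolderConjugate (1 / q) := by
    rw [Real.holderConjugate_iff]
    constructor
    · rw [lt_div_iff₀ hp]; linarith
    · simpa using hpq
  have h := ENNReal.young_inequality (a ^ p) (b ^ q) hc
  rw [← ENNReal.rpow_mul, ← ENNReal.rpow_mul, mul_one_div_cancel hp.ne', mul_one_div_cancel hq.ne',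
    ENNReal.rpow_one, ENNReal.rpow_one, ENNReal.div_eq_inv_mul, ENNReal.div_eq_inv_mul,
    ← ENNReal.ofReal_inv_of_pos (by positivity), ← ENNReal.ofReal_inv_of_pos (by positivity)] at h
  simpa using h

theorem prekopa_leindler_real_of_iSup_eq_one {p q : ℝ} (hp : 0 < p) (hq : 0 < q) (hpq : p + q = 1)
    {f g h : ℝ → ℝ≥0∞} (hf : Measurable f) (hg : Measurable g) (hh : Measurable h)
    (hf1 : ⨆ x, f x = 1) (hg1 : ⨆ x, g x = 1)
    (H : ∀ x y, f x ^ p * g y ^ q ≤ h (p * x + q * y)) :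
    (∫⁻ x, f x) ^ p * (∫⁻ x, g x) ^ q ≤ ∫⁻ x, h x := by
  have hfle : ∀ x, f x ≤ 1 := fun x => hf1 ▸ le_iSup f x
  have hgle : ∀ x, g x ≤ 1 := fun x => hg1 ▸ le_iSup g x
  refine (ENNReal.rpow_mul_rpow_le_weighted_add hp hq hpq _ _).trans ?_
  refine le_trans ?_ (lintegral_mono (fun x => min_le_left (h x) 1))
  have hhm : Measurable fun x => min (h x) 1 := hh.min measurable_const
  have hanti : ∀ k : ℝ → ℝ≥0∞, Measurable fun t : ℝ => volume {x | ENNReal.ofReal t < k x} := by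
    intro k
    refine Antitone.measurable fun s t hst => measure_mono fun x hx => ?_
    exact lt_of_le_of_lt (ENNReal.ofReal_le_ofReal hst) hx
  rw [lintegral_eq_setLIntegral_volume_lt hf hfle, lintegral_eq_setLIntegral_volume_lt hg hgle,
    lintegral_eq_setLIntegral_volume_lt hhm (fun x => min_le_right _ _),
    ← lintegral_const_mul _ (hanti f), ← lintegral_const_mul _ (hanti g),
    ← lintegral_add_left ((hanti f).const_mul _)]
  refine setLIntegral_mono' measurableSet_Ioo fun t ht => ?_
  have ht1 : ENNReal.ofReal t < 1 := by
    rw [← ENNReal.ofReal_one]; exact (ENNReal.ofReal_lt_ofReal_iff one_pos).2 ht.2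
  have hne : ∀ k : ℝ → ℝ≥0∞, ⨆ x, k x = 1 → {x | ENNReal.ofReal t < k x}.Nonempty := by
    intro k hk
    rw [← hk] at ht1
    exact lt_iSup_iff.1 ht1
  refine weighted_volume_add_le hp hq (measurableSet_lt measurable_const hf)
    (measurableSet_lt measurable_const hg) (hne f hf1) (hne g hg1) ?_
  intro x hx y hy
  simp only [Set.mem_ofPred_eq] at hx hy ⊢
  refine lt_min (lt_of_lt_of_le ?_ (H x y)) ht1
  calc ENNReal.ofReal t = ENNReal.ofReal t ^ p * ENNReal.ofReal t ^ q := by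
        rw [← ENNReal.rpow_add_of_nonneg _ _ hp.le hq.le, hpq, ENNReal.rpow_one]
    _ < f x ^ p * g y ^ q :=
        ENNReal.mul_lt_mul (ENNReal.rpow_lt_rpow hx hp) (ENNReal.rpow_lt_rpow hy hq)

theorem prekopa_leindler_real_of_bounded {p q : ℝ} (hp : 0 < p) (hq : 0 < q) (hpq : p + q = 1)
    {f g h : ℝ → ℝ≥0∞} (hf : Measurable f) (hg : Measurable g) (hh : Measurable h)
    (hf1 : ⨆ x, f x ≠ ∞) (hg1 : ⨆ x, g x ≠ ∞)
    (H : ∀ x y, f x ^ p * g y ^ q ≤ h (p * x + q * y)) :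
    (∫⁻ x, f x) ^ p * (∫⁻ x, g x) ^ q ≤ ∫⁻ x, h x := by
  set S := ⨆ x, f x with hS
  set T := ⨆ x, g x with hT
  by_cases hS0 : S = 0
  · have : ∀ x, f x = 0 := by simpa [hS] using hS0
    simp [this, hp]
  by_cases hT0 : T = 0
  · have : ∀ x, g x = 0 := by simpa [hT] using hT0
    simp [this, hq]
  have key := prekopa_leindler_real_of_iSup_eq_one hp hq hpq (f := fun x => S⁻¹ * f x)
    (g := fun x => T⁻¹ * g x) (h := fun x => ((S⁻¹) ^ p * (T⁻¹) ^ q) * h x)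
    (hf.const_mul _) (hg.const_mul _) (hh.const_mul _)
    (by rw [← ENNReal.mul_iSup, ← hS, ENNReal.inv_mul_cancel hS0 hf1])
    (by rw [← ENNReal.mul_iSup, ← hT, ENNReal.inv_mul_cancel hT0 hg1])
    (by
      intro x y
      rw [ENNReal.mul_rpow_of_nonneg _ _ hp.le, ENNReal.mul_rpow_of_nonneg _ _ hq.le,
        mul_mul_mul_comm]
      gcongr
      exact H x y)
  rw [lintegral_const_mul _ hf, lintegral_const_mul _ hg, lintegral_const_mul _ hh,
    ENNReal.mul_rpow_of_nonneg _ _ hp.le, ENNReal.mul_rpow_of_nonneg _ _ hq.le,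
    mul_mul_mul_comm] at key
  refine (ENNReal.mul_le_mul_iff_right ?_ ?_).1 key
  · have := ENNReal.rpow_pos (p := p) (ENNReal.inv_pos.2 hf1) (ENNReal.inv_ne_top.2 hS0)
    have := ENNReal.rpow_pos (p := q) (ENNReal.inv_pos.2 hg1) (ENNReal.inv_ne_top.2 hT0)
    positivity
  · exact ENNReal.mul_ne_top (ENNReal.rpow_ne_top_of_nonneg hp.le (ENNReal.inv_ne_top.2 hS0))
      (ENNReal.rpow_ne_top_of_nonneg hq.le (ENNReal.inv_ne_top.2 hT0))

theorem iSup_lintegral_min_natCast {f : ℝ → ℝ≥0∞} (hf : Measurable f) :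
    ⨆ N : ℕ, ∫⁻ x, min (f x) N = ∫⁻ x, f x := by
  rw [← lintegral_iSup (fun N => hf.min measurable_const)]
  · congr 1 with x
    change ⨆ N : ℕ, f x ⊓ (N : ℝ≥0∞) = f x
    rw [← inf_iSup_eq, ENNReal.iSup_natCast, inf_top_eq]
  · intro M N h x
    exact min_le_min le_rfl (by exact_mod_cast h)

theorem prekopa_leindler_real {p q : ℝ} (hp : 0 < p) (hq : 0 < q) (hpq : p + q = 1)
    {f g h : ℝ → ℝ≥0∞} (hf : Measurable f) (hg : Measurable g) (hh : Measurable h)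
    (H : ∀ x y, f x ^ p * g y ^ q ≤ h (p * x + q * y)) :
    (∫⁻ x, f x) ^ p * (∫⁻ x, g x) ^ q ≤ ∫⁻ x, h x := by
  rw [← iSup_lintegral_min_natCast hf, ← iSup_lintegral_min_natCast hg,
    ← ENNReal.orderIsoRpow_apply p hp, ← ENNReal.orderIsoRpow_apply q hq, OrderIso.map_iSup,
    OrderIso.map_iSup]
  simp only [ENNReal.orderIsoRpow_apply]
  rw [ENNReal.iSup_mul]
  refine iSup_le fun M => ?_
  rw [ENNReal.mul_iSup]
  refine iSup_le fun N => ?_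
  refine prekopa_leindler_real_of_bounded hp hq hpq (hf.min measurable_const)
    (hg.min measurable_const) hh ?_ ?_ fun x y => le_trans ?_ (H x y)
  · exact ne_top_of_le_ne_top (ENNReal.natCast_ne_top M) (iSup_le fun x => min_le_right _ _)
  · exact ne_top_of_le_ne_top (ENNReal.natCast_ne_top N) (iSup_le fun x => min_le_right _ _)
  · gcongr <;> exact min_le_left _ _

theorem prekopa_leindler_pi {p q : ℝ} (hp : 0 < p) (hq : 0 < q) (hpq : p + q = 1) (n : ℕ)
    {f g h : (Fin n → ℝ) → ℝ≥0∞} (hf : Measurable f) (hg : Measurable g) (hh : Measurable h)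
    (H : ∀ x y, f x ^ p * g y ^ q ≤ h (p • x + q • y)) :
    (∫⁻ x, f x) ^ p * (∫⁻ x, g x) ^ q ≤ ∫⁻ x, h x := by
  induction n with
  | zero =>
    rw [Measure.volume_pi_eq_dirac 0]
    simp only [lintegral_dirac' _ hf, lintegral_dirac' _ hg, lintegral_dirac' _ hh]
    simpa using H 0 0
  | succ n ih =>
    let e := (MeasurableEquiv.piFinSuccAbove (fun _ : Fin (n + 1) => ℝ) 0).symm
    have he : MeasurePreserving e volume volume :=
      (volume_preserving_piFinSuccAbove (fun _ : Fin (n + 1) => ℝ) 0).symm _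
    have hlin : ∀ (s t : ℝ) (u v : Fin n → ℝ),
        e (p * s + q * t, p • u + q • v) = p • e (s, u) + q • e (t, v) := by
      intro s t u v
      ext i
      refine Fin.cases ?_ (fun j => ?_) i <;> simp [e]
    have hint : ∀ {k : (Fin (n + 1) → ℝ) → ℝ≥0∞}, Measurable k →
        ∫⁻ x, k x = ∫⁻ s : ℝ, ∫⁻ u : Fin n → ℝ, k (e (s, u)) := by
      intro k hk
      rw [← he.lintegral_comp hk]
      exact lintegral_prod _ (hk.comp e.measurable).aemeasurable
    have hmeas : ∀ {k : (Fin (n + 1) → ℝ) → ℝ≥0∞}, Measurable k →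
        Measurable fun s : ℝ => ∫⁻ u : Fin n → ℝ, k (e (s, u)) := by
      intro k hk
      exact Measurable.lintegral_prod_right' (f := fun z => k (e z)) (hk.comp e.measurable)
    have hsec : ∀ {k : (Fin (n + 1) → ℝ) → ℝ≥0∞}, Measurable k → ∀ s : ℝ,
        Measurable fun u : Fin n → ℝ => k (e (s, u)) := by
      intro k hk s
      exact hk.comp (e.measurable.comp measurable_prodMk_left)
    rw [hint hf, hint hg, hint hh]
    refine prekopa_leindler_real hp hq hpq (hmeas hf) (hmeas hg) (hmeas hh) fun s t => ?_
    refine ih (hsec hf s) (hsec hg t) (hsec hh _) fun u v => ?_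
    rw [hlin]
    exact H _ _

theorem brunn_minkowski_rpow_mul_rpow_le {n : ℕ} {p q : ℝ} (hp : 0 < p) (hq : 0 < q)
    (hpq : p + q = 1) {A B C : Set (EuclideanSpace ℝ (Fin n))} (hA : MeasurableSet A)
    (hB : MeasurableSet B) (hC : MeasurableSet C) (H : ∀ x ∈ A, ∀ y ∈ B, p • x + q • y ∈ C) :
    volume A ^ p * volume B ^ q ≤ volume C := by
  let e := MeasurableEquiv.toLp 2 (Fin n → ℝ)
  have hvol : ∀ {S : Set (EuclideanSpace ℝ (Fin n))}, MeasurableSet S →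
      volume S = ∫⁻ x : Fin n → ℝ, (e ⁻¹' S).indicator 1 x := by
    intro S hS
    rw [lintegral_indicator_one (e.measurable hS)]
    exact ((PiLp.volume_preserving_toLp (Fin n)).measure_preimage hS.nullMeasurableSet).symm
  rw [hvol hA, hvol hB, hvol hC]
  have hm : ∀ {S : Set (EuclideanSpace ℝ (Fin n))}, MeasurableSet S →
      Measurable ((e ⁻¹' S).indicator (1 : (Fin n → ℝ) → ℝ≥0∞)) :=
    fun hS => measurable_one.indicator (e.measurable hS)
  refine prekopa_leindler_pi hp hq hpq n (hm hA) (hm hB) (hm hC) fun x y => ?_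
  by_cases hx : x ∈ e ⁻¹' A
  · by_cases hy : y ∈ e ⁻¹' B
    · have hz : p • x + q • y ∈ e ⁻¹' C := H _ hx _ hy
      rw [Set.indicator_of_mem hx, Set.indicator_of_mem hy, Set.indicator_of_mem hz]
      simp
    · simp [Set.indicator_of_notMem hy, hq]
  · simp [Set.indicator_of_notMem hx, hp]

open scoped Pointwise in
theorem brunn_minkowski_thickening {n : ℕ} (hn : 2 ≤ n) {A C : Set (EuclideanSpace ℝ (Fin n))}
    (hA : MeasurableSet A) (hC : MeasurableSet C) (hCfin : volume C ≠ ∞)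
    {ε : ℝ} (hε : 0 < ε) (H : ∀ x ∈ A, ∀ y, dist y x < ε → y ∈ C) :
    volume.real A + ε * (n * volume.real (ball (0 : EuclideanSpace ℝ (Fin n)) 1) ^ (1 / (n : ℝ))
      * volume.real A ^ (((n : ℝ) - 1) / n)) ≤ volume.real C := by
  have hn0 : (n : ℝ) ≠ 0 := by positivity
  have hn1 : (0 : ℝ) < (n : ℝ) - 1 := by
    have : (2 : ℝ) ≤ n := by exact_mod_cast hn
    linarith
  have hAC : A ⊆ C := fun x hx => H x hx x (by simpa using hε)
  have hAfin : volume A ≠ ∞ := measure_ne_top_of_subset hAC hCfin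
  have hne : Nonempty (Fin n) := ⟨⟨0, by omega⟩⟩
  rcases eq_or_lt_of_le (measureReal_nonneg (μ := volume) (s := A)) with h0 | hpos
  · rw [← h0, Real.zero_rpow (by positivity)]
    simp
  set a := volume.real A ^ (1 / (n : ℝ)) with ha
  set b := volume.real (ball (0 : EuclideanSpace ℝ (Fin n)) 1) ^ (1 / (n : ℝ)) with hb
  have hBfin : volume (ball (0 : EuclideanSpace ℝ (Fin n)) 1) ≠ ∞ := measure_ball_lt_top.ne
  have hBpos : 0 < volume.real (ball (0 : EuclideanSpace ℝ (Fin n)) 1) :=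
    ENNReal.toReal_pos (measure_ball_pos _ _ one_pos).ne' hBfin
  have hapos : 0 < a := Real.rpow_pos_of_pos hpos _
  have hbpos : 0 < b := Real.rpow_pos_of_pos hBpos _
  have han : a ^ n = volume.real A := by
    rw [ha, ← Real.rpow_natCast, ← Real.rpow_mul hpos.le, one_div_mul_cancel hn0, Real.rpow_one]
  have hbn : b ^ n = volume.real (ball (0 : EuclideanSpace ℝ (Fin n)) 1) := by
    rw [hb, ← Real.rpow_natCast, ← Real.rpow_mul hBpos.le, one_div_mul_cancel hn0, Real.rpow_one]
  have han1 : volume.real A ^ (((n : ℝ) - 1) / n) = a ^ (n - 1) := by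
    rw [ha, ← Real.rpow_natCast, ← Real.rpow_mul hpos.le]
    congr 1
    rw [Nat.cast_sub (by omega), Nat.cast_one]
    ring
  set s := a + ε * b with hs
  have hspos : 0 < s := by positivity
  have hp : 0 < a / s := by positivity
  have hq : 0 < ε * b / s := by positivity
  have hpq : a / s + ε * b / s = 1 := by rw [← add_div, ← hs, div_self hspos.ne']
  have key := brunn_minkowski_rpow_mul_rpow_le hp hq hpq (hA.const_smul₀ (s / a))
    (measurableSet_ball (x := (0 : EuclideanSpace ℝ (Fin n))) (ε := s / b)) hC (by
      rintro _ ⟨x, hx, rfl⟩ y hy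
      refine H x hx _ ?_
      simp only [smul_smul]
      rw [div_mul_div_cancel₀ hspos.ne', div_self hapos.ne', one_smul, dist_eq_norm,
        add_sub_cancel_left, norm_smul, Real.norm_of_nonneg hq.le]
      rw [mem_ball_zero_iff] at hy
      calc ε * b / s * ‖y‖ < ε * b / s * (s / b) := by gcongr
        _ = ε := by field_simp)
  have hA' : volume ((s / a) • A) = ENNReal.ofReal (s ^ n) := by
    rw [Measure.addHaar_smul, finrank_euclideanSpace_fin, abs_of_pos (by positivity),
      ← ENNReal.ofReal_toReal hAfin, ← ENNReal.ofReal_mul (by positivity)]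
    congr 1
    change (s / a) ^ n * volume.real A = _
    rw [← han, div_pow, div_mul_cancel₀ _ (by positivity)]
  have hB' : volume (ball (0 : EuclideanSpace ℝ (Fin n)) (s / b)) = ENNReal.ofReal (s ^ n) := by
    rw [Measure.addHaar_ball _ _ (by positivity), finrank_euclideanSpace_fin,
      ← ENNReal.ofReal_toReal hBfin, ← ENNReal.ofReal_mul (by positivity)]
    congr 1
    change (s / b) ^ n * volume.real _ = _
    rw [← hbn, div_pow, div_mul_cancel₀ _ (by positivity)]
  rw [hA', hB', ← ENNReal.rpow_add_of_nonneg _ _ hp.le hq.le, hpq, ENNReal.rpow_one,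
    ENNReal.ofReal_le_iff_le_toReal hCfin] at key
  refine le_trans ?_ key
  rw [han1, ← han]
  have hber := one_add_mul_le_pow (a := ε * b / a)
    (by have : 0 ≤ ε * b / a := by positivity
        linarith) n
  have hsn : s ^ n = a ^ n * (1 + ε * b / a) ^ n := by
    rw [← mul_pow]; congr 1; rw [hs]; field_simp
  rw [hsn]
  refine le_trans (le_of_eq ?_) (mul_le_mul_of_nonneg_left hber (by positivity))
  obtain ⟨m, rfl⟩ : ∃ m, n = m + 1 := ⟨n - 1, by omega⟩
  rw [Nat.add_sub_cancel]
  field_simp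
  ring

theorem sub_mul_rpow_le {x y θ : ℝ} (hθ : 0 < θ) (hy : 0 < y) (hyx : y ≤ x) :
    (x - y) * x ^ (-(1 + θ)) ≤ (y ^ (-θ) - x ^ (-θ)) / θ := by
  have hx : 0 < x := hy.trans_le hyx
  have hr : 0 < y / x := by positivity
  have hber : 1 + θ * (1 - y / x) ≤ (y / x) ^ (-θ) := by
    rw [Real.rpow_def_of_pos hr]
    have h1 := Real.add_one_le_exp (Real.log (y / x) * (-θ))
    have h2 := Real.log_le_sub_one_of_pos hr
    nlinarith
  rw [Real.div_rpow hy.le hx.le] at hber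
  have hxp : 0 < x ^ (-θ) := Real.rpow_pos_of_pos hx _
  rw [le_div_iff₀ hxp] at hber
  rw [le_div_iff₀ hθ, show -(1 + θ) = -θ - 1 by ring, Real.rpow_sub_one hx.ne']
  have : (x - y) * (x ^ (-θ) / x) * θ = θ * (1 - y / x) * x ^ (-θ) := by
    field_simp
  rw [this]
  linarith

theorem sum_sub_mul_rpow_le {θ v : ℝ} (hθ : 0 < θ) (hv : 0 < v) {V : ℕ → ℝ} (hV : Antitone V)
    (k : ℕ) (hvk : ∀ i ≤ k, v ≤ V i) :
    ∑ i ∈ Finset.range k, (V i - V (i + 1)) * V i ^ (-(1 + θ)) ≤ v ^ (-θ) / θ := by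
  calc ∑ i ∈ Finset.range k, (V i - V (i + 1)) * V i ^ (-(1 + θ))
      ≤ ∑ i ∈ Finset.range k, (V (i + 1) ^ (-θ) / θ - V i ^ (-θ) / θ) := by
        refine Finset.sum_le_sum fun i hi => ?_
        rw [Finset.mem_range] at hi
        rw [← sub_div]
        exact sub_mul_rpow_le hθ (hv.trans_le (hvk _ (by omega))) (hV (Nat.le_succ i))
    _ = V k ^ (-θ) / θ - V 0 ^ (-θ) / θ :=
        Finset.sum_range_sub (fun i => V i ^ (-θ) / θ) k
    _ ≤ v ^ (-θ) / θ := by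
        have h1 : V k ^ (-θ) ≤ v ^ (-θ) :=
          Real.rpow_le_rpow_of_nonpos hv (hvk k le_rfl) (by linarith)
        have h2 : 0 ≤ V 0 ^ (-θ) := Real.rpow_nonneg (hv.le.trans (hvk 0 (by omega))) _
        have h3 : V k ^ (-θ) / θ ≤ v ^ (-θ) / θ := by gcongr
        have h4 : 0 ≤ V 0 ^ (-θ) / θ := by positivity
        linarith

theorem mul_rpow_le_sum_rpow_div {α v M : ℝ} (hα : 0 < α) (hv : 0 < v) {V : ℕ → ℝ} {k : ℕ}
    (hk : 0 < k) (hvk : ∀ i ≤ k, v ≤ V i) (hM : V 0 ≤ M) :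
    k * (v / M) ^ (α / k) ≤ ∑ i ∈ Finset.range k, (V (i + 1) / V i) ^ α := by
  have hk' : (0 : ℝ) < k := by exact_mod_cast hk
  have hVpos : ∀ i ≤ k, 0 < V i := fun i hi => hv.trans_le (hvk i hi)
  have hMpos : 0 < M := (hVpos 0 (by omega)).trans_le hM
  have hr : ∀ i ∈ Finset.range k, 0 ≤ V (i + 1) / V i := by
    intro i hi
    rw [Finset.mem_range] at hi
    exact (div_pos (hVpos _ (by omega)) (hVpos _ (by omega))).le
  have h := Real.geom_mean_le_arith_mean_weighted (Finset.range k) (fun _ => 1 / (k : ℝ))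
    (fun i => (V (i + 1) / V i) ^ α) (fun _ _ => by positivity) (by simp [hk.ne'])
    (fun i hi => Real.rpow_nonneg (hr i hi) _)
  have hprod : ∀ m ≤ k, ∏ i ∈ Finset.range m, (V (i + 1) / V i) = V m / V 0 := by
    intro m hm
    induction m with
    | zero => simp [(hVpos 0 (by omega)).ne']
    | succ m ih =>
      have := (hVpos m (by omega)).ne'
      rw [Finset.prod_range_succ, ih (by omega)]
      field_simp
  rw [Real.finsetProd_rpow _ _ (fun i hi => Real.rpow_nonneg (hr i hi) _),
    Real.finsetProd_rpow _ _ hr, hprod k le_rfl, ← Finset.mul_sum,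
    ← Real.rpow_mul (div_pos (hVpos k le_rfl) (hVpos 0 (by omega))).le, mul_one_div] at h
  have hle : (v / M) ^ (α / k) ≤ (V k / V 0) ^ (α / k) := by
    have := hVpos 0 (by omega)
    have := hVpos k le_rfl
    have := hvk k le_rfl
    gcongr
  calc k * (v / M) ^ (α / k) ≤ k * (1 / k * ∑ i ∈ Finset.range k, (V (i + 1) / V i) ^ α) := by
        gcongr
        exact hle.trans h
    _ = _ := by field_simp

theorem sq_mul_rpow_le_sum {α θ c h v M : ℝ} (hα : 0 < α) (hθ : 0 < θ) (hαθ : 2 * α = 1 + θ)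
    (hc : 0 ≤ c) (hh : 0 ≤ h) (hv : 0 < v) {V E : ℕ → ℝ} (hV : Antitone V) {k : ℕ} (hk : 0 < k)
    (hvk : ∀ i ≤ k, v ≤ V i) (hM : V 0 ≤ M) (hE : ∀ i, 0 ≤ E i)
    (H : ∀ i < k, (c * h * V (i + 1) ^ α) ^ 2 ≤ E i * (V i - V (i + 1))) :
    (c * (h * k) * (v / M) ^ (α / k)) ^ 2 * (θ * v ^ θ) ≤ ∑ i ∈ Finset.range k, E i := by
  have hVpos : ∀ i ≤ k, 0 < V i := fun i hi => hv.trans_le (hvk i hi)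
  have hMpos : 0 < M := (hVpos 0 (by omega)).trans_le hM
  have hsum : 0 ≤ ∑ i ∈ Finset.range k, E i := Finset.sum_nonneg fun i _ => hE i
  have hdiff : ∀ i, 0 ≤ V i - V (i + 1) := fun i => sub_nonneg.2 (hV (Nat.le_succ i))
  have h1 : c * (h * k) * (v / M) ^ (α / k)
      ≤ ∑ i ∈ Finset.range k, √(E i) * √((V i - V (i + 1)) * V i ^ (-(1 + θ))) := by
    calc c * (h * k) * (v / M) ^ (α / k) = c * h * (k * (v / M) ^ (α / k)) := by ring
      _ ≤ c * h * ∑ i ∈ Finset.range k, (V (i + 1) / V i) ^ α := by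
          gcongr
          exact mul_rpow_le_sum_rpow_div hα hv hk hvk hM
      _ ≤ _ := by
          rw [Finset.mul_sum]
          refine Finset.sum_le_sum fun i hi => ?_
          rw [Finset.mem_range] at hi
          have hp := hVpos i hi.le
          have hp1 := hVpos (i + 1) hi
          rw [← Real.sqrt_mul (hE i)]
          refine Real.le_sqrt_of_sq_le ?_
          have e1 : V i ^ (-(1 + θ)) = ((V i ^ α)⁻¹) ^ 2 := by
            rw [← hαθ, Real.rpow_neg hp.le, two_mul, Real.rpow_add hp, sq, mul_inv]
          rw [e1, Real.div_rpow hp1.le hp.le, ← mul_assoc]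
          calc (c * h * (V (i + 1) ^ α / V i ^ α)) ^ 2
              = (c * h * V (i + 1) ^ α) ^ 2 * ((V i ^ α)⁻¹) ^ 2 := by
                rw [← mul_pow]; congr 1; ring
            _ ≤ _ := by gcongr; exact H i hi
  have h2 := Finset.sum_mul_sq_le_sq_mul_sq (Finset.range k) (fun i => √(E i))
    (fun i => √((V i - V (i + 1)) * V i ^ (-(1 + θ))))
  have h3 : ∑ i ∈ Finset.range k, √(E i) ^ 2 = ∑ i ∈ Finset.range k, E i :=
    Finset.sum_congr rfl fun i _ => Real.sq_sqrt (hE i)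
  have h4 : ∑ i ∈ Finset.range k, √((V i - V (i + 1)) * V i ^ (-(1 + θ))) ^ 2
      = ∑ i ∈ Finset.range k, (V i - V (i + 1)) * V i ^ (-(1 + θ)) := by
    refine Finset.sum_congr rfl fun i hi => Real.sq_sqrt ?_
    rw [Finset.mem_range] at hi
    exact mul_nonneg (hdiff i) (Real.rpow_nonneg (hVpos i hi.le).le _)
  rw [h3, h4] at h2
  have h5 := sum_sub_mul_rpow_le hθ hv hV k hvk
  have hvθ : 0 < v ^ θ := Real.rpow_pos_of_pos hv _
  calc (c * (h * k) * (v / M) ^ (α / k)) ^ 2 * (θ * v ^ θ)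
      ≤ ((∑ i ∈ Finset.range k, E i) * (v ^ (-θ) / θ)) * (θ * v ^ θ) := by
        gcongr
        refine le_trans (pow_le_pow_left₀ (by positivity) h1 2) (h2.trans ?_)
        gcongr
    _ = ∑ i ∈ Finset.range k, E i := by
        rw [Real.rpow_neg hv.le]
        field_simp

theorem norm_gradient {n : ℕ} (w : EuclideanSpace ℝ (Fin n) → ℝ) (x : EuclideanSpace ℝ (Fin n)) :
    ‖gradient w x‖ = ‖fderiv ℝ w x‖ := by
  simp [gradient]

theorem exists_forall_le_add_norm_gradient {n : ℕ} {w : EuclideanSpace ℝ (Fin n) → ℝ}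
    (hw : ContDiff ℝ (⊤ : ℕ∞) w) (hs : HasCompactSupport w) :
    ∃ K : ℝ, 0 ≤ K ∧ ∀ x y, w x ≤ w y + ‖gradient w y‖ * dist x y + K * dist x y ^ 2 := by
  obtain ⟨K, hK⟩ := ContDiff.lipschitzWith_of_hasCompactSupport (𝕂 := ℝ) (n := 1)
    (hs.fderiv (𝕜 := ℝ)) (hw.fderiv_right (by norm_cast)) one_ne_zero
  refine ⟨K, K.2, fun x y => ?_⟩
  have hd : Differentiable ℝ w := hw.differentiable (by simp)
  have h := Convex.norm_image_sub_le_of_norm_fderiv_le' (𝕜 := ℝ) (f := w) (φ := fderiv ℝ w y)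
    (s := closedBall y (dist x y)) (C := K * dist x y) (x := y) (y := x)
    (fun z _ => hd z) (fun z hz => ?_) (convex_closedBall _ _)
    (mem_closedBall_self dist_nonneg) (by simp)
  · have h2 := (fderiv ℝ w y).le_opNorm (x - y)
    rw [Real.norm_eq_abs] at h h2
    have h3 := le_abs_self (w x - w y - fderiv ℝ w y (x - y))
    have h4 := le_abs_self (fderiv ℝ w y (x - y))
    rw [← dist_eq_norm] at h h2
    rw [norm_gradient]
    nlinarith
  · rw [← dist_eq_norm]
    exact (hK.dist_le_mul z y).trans (by gcongr; exact hz)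

theorem lintegral_volume_diff_superlevel_le {X : Type*} [MeasurableSpace X] {μ : Measure X}
    [SFinite μ] {u v g : X → ℝ} (hu : Measurable u) (hv : Measurable v)
    {a b : ℝ} {D : Set X} (hD : MeasurableSet D)
    (hDmem : ∀ x, u x < b → a ≤ v x → u x < v x → x ∈ D)
    (hg : ∀ x, v x - u x ≤ g x) :
    ∫⁻ t in Set.Ico a b, μ ({x | t ≤ v x} \ {x | t ≤ u x}) ≤ ∫⁻ x in D, ENNReal.ofReal (g x) ∂μ := by
  let S : Set (X × ℝ) := {z | a ≤ z.2 ∧ z.2 < b ∧ u z.1 < z.2 ∧ z.2 ≤ v z.1}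
  have hS : MeasurableSet S :=
    (measurableSet_le measurable_const measurable_snd).inter
      ((measurableSet_lt measurable_snd measurable_const).inter
        ((measurableSet_lt (hu.comp measurable_fst) measurable_snd).inter
          (measurableSet_le measurable_snd (hv.comp measurable_fst))))
  have h1 : ∫⁻ t in Set.Ico a b, μ ({x | t ≤ v x} \ {x | t ≤ u x}) = μ.prod volume S := by
    rw [Measure.prod_apply_symm hS, ← lintegral_indicator measurableSet_Ico]
    congr 1 with t
    by_cases ht : t ∈ Set.Ico a b
    · rw [Set.indicator_of_mem ht]
      congr 1
      ext x
      have := ht.1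
      have := ht.2
      simp only [Set.mem_sdiff, Set.mem_ofPred_eq, Set.mem_preimage, S]
      grind
    · rw [Set.indicator_of_notMem ht]
      refine (measure_mono_null (t := ∅) ?_ measure_empty).symm
      intro x hx
      exact ht ⟨hx.1, hx.2.1⟩
  rw [h1, Measure.prod_apply hS, ← lintegral_indicator hD]
  refine lintegral_mono fun x => ?_
  by_cases hx : x ∈ D
  · rw [Set.indicator_of_mem hx]
    refine (measure_mono (t := Set.Ioc (u x) (v x)) fun t ht => ⟨ht.2.2.1, ht.2.2.2⟩).trans ?_
    rw [Real.volume_Ioc]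
    exact ENNReal.ofReal_le_ofReal (hg x)
  · rw [Set.indicator_of_notMem hx]
    refine le_of_eq (measure_mono_null (t := ∅) ?_ measure_empty)
    rintro t ⟨h2, h3, h4, h5⟩
    exact hx (hDmem x (h4.trans h3) (h2.trans h5) (h4.trans_le h5))

theorem continuous_norm_gradient {n : ℕ} {w : EuclideanSpace ℝ (Fin n) → ℝ}
    (hw : ContDiff ℝ (⊤ : ℕ∞) w) : Continuous fun x => ‖gradient w x‖ := by
  simp only [norm_gradient]
  exact (hw.continuous_fderiv (by simp)).norm

theorem hasCompactSupport_norm_gradient {n : ℕ} {w : EuclideanSpace ℝ (Fin n) → ℝ}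
    (hs : HasCompactSupport w) : HasCompactSupport fun x => ‖gradient w x‖ := by
  simp only [norm_gradient]
  exact (hs.fderiv (𝕜 := ℝ)).norm

theorem integrable_norm_gradient {n : ℕ} {w : EuclideanSpace ℝ (Fin n) → ℝ}
    (hw : ContDiff ℝ (⊤ : ℕ∞) w) (hs : HasCompactSupport w) :
    Integrable fun x => ‖gradient w x‖ :=
  (continuous_norm_gradient hw).integrable_of_hasCompactSupport (hasCompactSupport_norm_gradient hs)

theorem volume_superlevel_ne_top {n : ℕ} {w : EuclideanSpace ℝ (Fin n) → ℝ}
    (hs : HasCompactSupport w) {t : ℝ} (ht : 0 < t) : volume {x | t ≤ w x} ≠ ∞ := by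
  refine measure_ne_top_of_subset (fun x hx => ?_) hs.isCompact.measure_lt_top.ne
  refine subset_tsupport w ?_
  rw [Function.mem_support]
  exact (ht.trans_le hx).ne'

theorem rpow_volume_superlevel_le_of_small {n : ℕ} (hn : 2 ≤ n)
    {w : EuclideanSpace ℝ (Fin n) → ℝ} (hw : ContDiff ℝ (⊤ : ℕ∞) w) (hs : HasCompactSupport w)
    {K L : ℝ} (hK : ∀ x y, w x ≤ w y + ‖gradient w y‖ * dist x y + K * dist x y ^ 2)
    (hK0 : 0 ≤ K) (hL : ∀ x, ‖gradient w x‖ ≤ L) {a a' b ε : ℝ} (ha : 0 < a) (hab : a' ≤ b)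
    (hε : 0 < ε) (hεa : ε * L + K * ε ^ 2 < a' - a) :
    (b - a') * (n * volume.real (ball (0 : EuclideanSpace ℝ (Fin n)) 1) ^ (1 / (n : ℝ))
      * volume.real {x | b ≤ w x} ^ (((n : ℝ) - 1) / n)) ≤
      (∫ x in {x | a ≤ w x ∧ w x < b}, ‖gradient w x‖)
        + K * ε * volume.real {x | a ≤ w x ∧ w x < b} := by
  have hα : 0 ≤ ((n : ℝ) - 1) / n := by
    have : (2 : ℝ) ≤ n := by exact_mod_cast hn
    apply div_nonneg <;> linarith
  set B := volume.real (ball (0 : EuclideanSpace ℝ (Fin n)) 1) ^ (1 / (n : ℝ))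
  have hB0 : 0 ≤ B := Real.rpow_nonneg measureReal_nonneg _
  set D := {x | a ≤ w x ∧ w x < b}
  let P : EuclideanSpace ℝ (Fin n) → ℝ := fun x => w x + (ε * ‖gradient w x‖ + K * ε ^ 2)
  have hL0 : 0 ≤ L := (norm_nonneg _).trans (hL 0)
  have hKε : 0 ≤ K * ε ^ 2 := by positivity
  have hwc : Continuous w := hw.continuous
  have hGc := continuous_norm_gradient hw
  have hPc : Continuous P := by fun_prop
  have hDm : MeasurableSet D :=
    (measurableSet_le measurable_const hwc.measurable).inter
      (measurableSet_lt hwc.measurable measurable_const)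
  have hDfin : volume D ≠ ∞ :=
    measure_ne_top_of_subset (fun x hx => hx.1) (volume_superlevel_ne_top hs ha)
  have hPle : ∀ x, P x ≤ w x + (ε * L + K * ε ^ 2) := fun x => by
    simp only [P]; have := hL x; gcongr
  have hPsub : ∀ x, a' ≤ P x → a ≤ w x := fun x hx => by
    have := hPle x; linarith
  have ha'0 : 0 < a' := by nlinarith
  have htop := lintegral_volume_diff_superlevel_le (μ := volume) (u := w) (v := P)
    (g := fun x => ε * ‖gradient w x‖ + K * ε ^ 2) (a := a') (b := b) hwc.measurable
    hPc.measurable hDm (fun x h1 h2 _ => ⟨hPsub x h2, h1⟩) (fun x => by simp [P])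
  have hint : IntegrableOn (fun x => ε * ‖gradient w x‖ + K * ε ^ 2) D :=
    ((integrable_norm_gradient hw hs).integrableOn.const_mul ε).add (integrableOn_const hDfin)
  rw [← ofReal_integral_eq_lintegral_ofReal hint (Eventually.of_forall fun x => by positivity),
    integral_add ((integrable_norm_gradient hw hs).integrableOn.const_mul ε)
      (integrableOn_const hDfin), integral_const_mul, setIntegral_const, smul_eq_mul] at htop
  have hbot : ENNReal.ofReal ((b - a') * (ε * (n * B * volume.real {x | b ≤ w x} ^
      (((n : ℝ) - 1) / n)))) ≤
      ∫⁻ t in Set.Ico a' b, volume ({x | t ≤ P x} \ {x | t ≤ w x}) := by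
    rw [ENNReal.ofReal_mul (by linarith), mul_comm, ← Real.volume_Ico, ← setLIntegral_const]
    refine setLIntegral_mono' measurableSet_Ico fun t ht => ?_
    have ht0 : 0 < t := ha'0.trans_le ht.1
    have hAm : MeasurableSet {x | t ≤ w x} := measurableSet_le measurable_const hwc.measurable
    have hCm : MeasurableSet {x | t ≤ P x} := measurableSet_le measurable_const hPc.measurable
    have hCfin : volume {x | t ≤ P x} ≠ ∞ :=
      measure_ne_top_of_subset (fun x hx => hPsub x (ht.1.trans hx))
        (volume_superlevel_ne_top hs ha)
    have hbm := brunn_minkowski_thickening hn hAm hCm hCfin hε (by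
      intro x hx y hxy
      have h1 := hK x y
      rw [dist_comm] at hxy
      have hx' : t ≤ w x := hx
      have h2 : ‖gradient w y‖ * dist x y ≤ ε * ‖gradient w y‖ := by
        rw [mul_comm]; gcongr
      have h3 : K * dist x y ^ 2 ≤ K * ε ^ 2 := by gcongr
      change t ≤ w y + (ε * ‖gradient w y‖ + K * ε ^ 2)
      linarith)
    rw [ENNReal.ofReal_le_iff_le_toReal (measure_ne_top_of_subset Set.sdiff_subset hCfin)]
    change _ ≤ volume.real _
    have hAC : {x | t ≤ w x} ⊆ {x | t ≤ P x} := fun x hx => by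
      have hx' : t ≤ w x := hx
      change t ≤ w x + (ε * ‖gradient w x‖ + K * ε ^ 2)
      have : 0 ≤ ε * ‖gradient w x‖ := by positivity
      linarith
    rw [measureReal_sdiff hAC hAm hCfin]
    have hmono : volume.real {x | b ≤ w x} ≤ volume.real {x | t ≤ w x} :=
      measureReal_mono (fun x hx => ht.2.le.trans hx) (volume_superlevel_ne_top hs ht0)
    have : ε * (n * B * volume.real {x | b ≤ w x} ^ (((n : ℝ) - 1) / n))
      ≤ ε * (n * B * volume.real {x | t ≤ w x} ^ (((n : ℝ) - 1) / n)) := by gcongr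
    linarith
  have hfin := hbot.trans htop
  have hI : 0 ≤ ∫ x in D, ‖gradient w x‖ := integral_nonneg fun x => norm_nonneg _
  rw [ENNReal.ofReal_le_ofReal_iff (by positivity)] at hfin
  refine le_of_mul_le_mul_left ?_ hε
  linarith

theorem rpow_volume_superlevel_le_integral_norm_gradient {n : ℕ} (hn : 2 ≤ n)
    {w : EuclideanSpace ℝ (Fin n) → ℝ} (hw : ContDiff ℝ (⊤ : ℕ∞) w) (hs : HasCompactSupport w)
    {a b : ℝ} (ha : 0 < a) (hab : a < b) :
    (b - a) * (n * volume.real (ball (0 : EuclideanSpace ℝ (Fin n)) 1) ^ (1 / (n : ℝ))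
      * volume.real {x | b ≤ w x} ^ (((n : ℝ) - 1) / n)) ≤
      ∫ x in {x | a ≤ w x ∧ w x < b}, ‖gradient w x‖ := by
  obtain ⟨K, hK0, hK⟩ := exists_forall_le_add_norm_gradient hw hs
  obtain ⟨L, hL⟩ := (hasCompactSupport_norm_gradient hs).exists_bound_of_continuous
    (continuous_norm_gradient hw)
  simp only [norm_norm] at hL
  set c := n * volume.real (ball (0 : EuclideanSpace ℝ (Fin n)) 1) ^ (1 / (n : ℝ))
      * volume.real {x | b ≤ w x} ^ (((n : ℝ) - 1) / n)
  set D := {x | a ≤ w x ∧ w x < b}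
  have h1 : ∀ a', a < a' → a' ≤ b → (b - a') * c ≤ ∫ x in D, ‖gradient w x‖ := by
    intro a' haa' hab'
    have hlim : Tendsto (fun ε : ℝ => (∫ x in D, ‖gradient w x‖) + K * ε * volume.real D)
        (𝓝[>] 0) (𝓝 ((∫ x in D, ‖gradient w x‖) + K * 0 * volume.real D)) :=
      (Continuous.tendsto (by fun_prop) 0).mono_left nhdsWithin_le_nhds
    have hsmall : ∀ᶠ ε : ℝ in 𝓝[>] 0, ε * L + K * ε ^ 2 < a' - a := by
      refine nhdsWithin_le_nhds ?_
      have : Continuous fun ε : ℝ => ε * L + K * ε ^ 2 := by fun_prop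
      exact this.tendsto 0 |>.eventually_lt_const (by simpa using haa')
    rw [mul_zero, zero_mul, add_zero] at hlim
    refine ge_of_tendsto hlim ?_
    filter_upwards [hsmall, self_mem_nhdsWithin] with ε h1 h2
    exact rpow_volume_superlevel_le_of_small hn hw hs hK hK0 hL ha hab' h2 h1
  have hlim : Tendsto (fun a' : ℝ => (b - a') * c) (𝓝[>] a) (𝓝 ((b - a) * c)) :=
    (Continuous.tendsto (by fun_prop) a).mono_left nhdsWithin_le_nhds
  refine le_of_tendsto hlim ?_
  filter_upwards [Ioc_mem_nhdsGT hab] with a' h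
  exact h1 a' h.1 h.2

theorem sq_setIntegral_le {X : Type*} [MeasurableSpace X] {μ : Measure X} {f : X → ℝ} {D : Set X}
    (hD : μ D ≠ ∞) (hf : IntegrableOn f D μ) (hf2 : IntegrableOn (fun x => f x ^ 2) D μ) :
    (∫ x in D, f x ∂μ) ^ 2 ≤ (∫ x in D, f x ^ 2 ∂μ) * μ.real D := by
  set J := ∫ x in D, f x ∂μ with hJ
  rcases eq_or_lt_of_le (measureReal_nonneg (μ := μ) (s := D)) with h0 | hpos
  · have : μ D = 0 := (measureReal_eq_zero_iff hD).1 h0.symm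
    have hJ0 : J = 0 := setIntegral_measure_zero f this
    simp [hJ0, ← h0]
  set m := μ.real D with hm
  have h : 0 ≤ ∫ x in D, (f x - J / m) ^ 2 ∂μ := integral_nonneg fun x => sq_nonneg _
  have he : ∀ x, (f x - J / m) ^ 2 = f x ^ 2 - 2 * (J / m) * f x + (J / m) ^ 2 := fun x => by ring
  simp only [he] at h
  have hsub : IntegrableOn (fun x => f x ^ 2 - 2 * (J / m) * f x) D μ :=
    hf2.sub (hf.const_mul _)
  rw [integral_add hsub (integrableOn_const hD),
    integral_sub hf2 (hf.const_mul _), integral_const_mul, setIntegral_const, ← hJ, ← hm,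
    smul_eq_mul] at h
  have : J ^ 2 / m ≤ ∫ x in D, f x ^ 2 ∂μ := by
    have e : 2 * (J / m) * J - m * (J / m) ^ 2 = J ^ 2 / m := by field_simp; ring
    linarith
  rwa [div_le_iff₀ hpos] at this

theorem capacity_lower_bound {n : ℕ} (hn : 3 ≤ n)
    {w : EuclideanSpace ℝ (Fin n) → ℝ} (hw : ContDiff ℝ (⊤ : ℕ∞) w) (hs : HasCompactSupport w)
    {v : ℝ} (hv : 0 < v) (hvw : v ≤ volume.real {x | 1 ≤ w x}) :
    (n * volume.real (ball (0 : EuclideanSpace ℝ (Fin n)) 1) ^ (1 / (n : ℝ))) ^ 2 *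
      (((n : ℝ) - 2) / n * v ^ (((n : ℝ) - 2) / n)) ≤ ∫ x, ‖gradient w x‖ ^ 2 := by
  have hn3 : (3 : ℝ) ≤ n := by exact_mod_cast hn
  set c := n * volume.real (ball (0 : EuclideanSpace ℝ (Fin n)) 1) ^ (1 / (n : ℝ))
  have hc0 : 0 ≤ c := mul_nonneg (by positivity) (Real.rpow_nonneg measureReal_nonneg _)
  set θ := ((n : ℝ) - 2) / n with hθ
  set α := ((n : ℝ) - 1) / n with hα
  have hθ0 : 0 < θ := div_pos (by linarith) (by linarith)
  have hα0 : 0 < α := div_pos (by linarith) (by linarith)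
  have hαθ : 2 * α = 1 + θ := by rw [hα, hθ]; field_simp; ring
  set M := volume.real (tsupport w)
  have hsupp : ∀ {t : ℝ}, 0 < t → {x | t ≤ w x} ⊆ tsupport w := fun ht x hx =>
    subset_tsupport w (ht.trans_le hx).ne'
  have hMpos : 0 < M :=
    hv.trans_le (hvw.trans (measureReal_mono (hsupp one_pos) hs.isCompact.measure_lt_top.ne))
  have hG2c : Continuous fun x => ‖gradient w x‖ ^ 2 := (continuous_norm_gradient hw).pow 2
  have hG2 : Integrable fun x => ‖gradient w x‖ ^ 2 := by
    refine hG2c.integrable_of_hasCompactSupport ?_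
    exact (hasCompactSupport_norm_gradient hs).comp_left (g := fun r : ℝ => r ^ 2) (by simp)
  have hk : ∀ k : ℕ, 0 < k → (c * (1 / ((k : ℝ) + 1) * k) * (v / M) ^ (α / k)) ^ 2 * (θ * v ^ θ)
      ≤ ∫ x, ‖gradient w x‖ ^ 2 := by
    intro k hk
    let t : ℕ → ℝ := fun i => (i + 1) / (k + 1)
    have ht0 : ∀ i, 0 < t i := fun i => by simp only [t]; positivity
    have htmono : StrictMono t := strictMono_nat_of_lt_succ fun i => by
      simp only [t]; gcongr; simp
    have htk : t k = 1 := by simp only [t]; field_simp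
    have hts : ∀ i, t (i + 1) - t i = 1 / ((k : ℝ) + 1) := fun i => by
      simp only [t]; push_cast; ring
    let A : ℕ → Set (EuclideanSpace ℝ (Fin n)) := fun i => {x | t i ≤ w x}
    have hAm : ∀ i, MeasurableSet (A i) := fun i =>
      measurableSet_le measurable_const hw.continuous.measurable
    have hAfin : ∀ i, volume (A i) ≠ ∞ := fun i => volume_superlevel_ne_top hs (ht0 i)
    have hAanti : Antitone A := fun i j hij x hx => (htmono.monotone hij).trans hx
    have hD : ∀ i, {x | t i ≤ w x ∧ w x < t (i + 1)} = A i \ A (i + 1) := fun i => by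
      ext x; simp [A]
    have hVanti : Antitone fun i => volume.real (A i) := fun i j hij =>
      measureReal_mono (hAanti hij) (hAfin i)
    have key := sq_mul_rpow_le_sum (α := α) (θ := θ) (c := c) (h := 1 / ((k : ℝ) + 1)) (v := v)
      (M := M) (V := fun i => volume.real (A i))
      (E := fun i => ∫ x in A i \ A (i + 1), ‖gradient w x‖ ^ 2) hα0 hθ0 hαθ hc0 (by positivity)
      hv hVanti hk
      (fun i hi => hvw.trans (measureReal_mono (fun x hx =>
        (htk ▸ htmono.monotone hi : t i ≤ 1).trans hx) (hAfin i)))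
      (measureReal_mono (hsupp (ht0 0)) hs.isCompact.measure_lt_top.ne)
      (fun i => integral_nonneg fun x => by positivity)
      (fun i hi => by
        have h1 := rpow_volume_superlevel_le_integral_norm_gradient (by omega) hw hs (ht0 i)
          (htmono (Nat.lt_succ_self i))
        have h2 := sq_setIntegral_le (measure_ne_top_of_subset Set.sdiff_subset (hAfin i))
          (integrable_norm_gradient hw hs).integrableOn (hG2.integrableOn (s := A i \ A (i + 1)))
        rw [hts, hD] at h1
        rw [measureReal_sdiff (hAanti (Nat.le_succ i)) (hAm _) (hAfin _)] at h2
        refine le_trans (pow_le_pow_left₀ ?_ ?_ 2) h2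
        · exact mul_nonneg (mul_nonneg hc0 (by positivity)) (Real.rpow_nonneg measureReal_nonneg _)
        · refine le_trans (le_of_eq ?_) h1
          simp only [A]
          ring)
    refine key.trans ?_
    have hsum : ∀ i, ∫ x in A i \ A (i + 1), ‖gradient w x‖ ^ 2
        = (∫ x in A i, ‖gradient w x‖ ^ 2) - ∫ x in A (i + 1), ‖gradient w x‖ ^ 2 := fun i =>
      setIntegral_sdiff (hAm _) hG2.integrableOn (hAanti (Nat.le_succ i))
    simp only [hsum]
    rw [Finset.sum_range_sub' (fun i => ∫ x in A i, ‖gradient w x‖ ^ 2)]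
    have h1 : 0 ≤ ∫ x in A k, ‖gradient w x‖ ^ 2 := integral_nonneg fun x => by positivity
    have h2 : ∫ x in A 0, ‖gradient w x‖ ^ 2 ≤ ∫ x, ‖gradient w x‖ ^ 2 :=
      setIntegral_le_integral hG2 (Eventually.of_forall fun x => by positivity)
    linarith
  have hlim1 : Tendsto (fun k : ℕ => 1 / ((k : ℝ) + 1) * k) atTop (𝓝 1) := by
    have := tendsto_natCast_div_add_atTop (1 : ℝ)
    refine this.congr fun k => by ring
  have hlim2 : Tendsto (fun k : ℕ => (v / M) ^ (α / (k : ℝ))) atTop (𝓝 1) := by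
    have h1 : Tendsto (fun k : ℕ => α / (k : ℝ)) atTop (𝓝 0) :=
      tendsto_const_div_atTop_nhds_zero_nat α
    have h2 := (Real.continuousAt_const_rpow (a := v / M) (b := 0) (by positivity)).tendsto.comp h1
    simpa [Function.comp_def] using h2
  have hlim := (((hlim1.const_mul c).mul hlim2).pow 2).mul_const (θ * v ^ θ)
  rw [mul_one, mul_one] at hlim
  exact le_of_tendsto hlim (eventually_atTop.2 ⟨1, fun k h => hk k h⟩)

/-- **Poincaré–Faber–Szegő inequality.** -/
theorem poincare_faber_szego {n : ℕ} (hn : 3 ≤ n) {Ω : Set (Euc n)}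
    (hbd : Bornology.IsBounded Ω) (hop : IsOpen Ω) (hsm : HasSmoothBoundary Ω) :
    ((volume Ω).toReal / (volume (ball (0 : Euc n) 1)).toReal) ^ (((n : ℝ) - 2) / n)
      ≤ capacity n Ω := by
  have hn3 : (3 : ℝ) ≤ n := by exact_mod_cast hn
  have hθ : 0 < ((n : ℝ) - 2) / n := div_pos (by linarith) (by linarith)
  have hne : Nonempty (Fin n) := ⟨⟨0, by omega⟩⟩
  set B := (volume (ball (0 : Euc n) 1)).toReal with hB
  have hBpos : 0 < B :=
    ENNReal.toReal_pos (measure_ball_pos _ _ one_pos).ne' measure_ball_lt_top.ne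
  have hcoef : 0 < 1 / (((n : ℝ) - 2) * sphereArea n) := by
    have h2 : 0 < (n : ℝ) - 2 := by linarith
    have h3 : 0 < sphereArea n := mul_pos (by linarith) hBpos
    positivity
  refine le_csInf ?_ ?_
  · obtain ⟨R, hR0, hR⟩ := hbd.subset_ball_lt 0 0
    let f : ContDiffBump (0 : Euc n) := ⟨R, R + 1, hR0, by linarith⟩
    exact ⟨_, f, f.contDiff, f.hasCompactSupport,
      fun x hx => f.one_of_mem_closedBall (ball_subset_closedBall (hR hx)), rfl⟩
  · rintro _ ⟨w, hw, hs, hw1, rfl⟩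
    rcases eq_or_lt_of_le (ENNReal.toReal_nonneg (a := volume Ω)) with h0 | hpos
    · rw [← h0, zero_div, Real.zero_rpow hθ.ne']
      exact mul_nonneg hcoef.le (integral_nonneg fun x => by positivity)
    have h := capacity_lower_bound hn hw hs hpos
      (measureReal_mono (fun x hx => (hw1 x hx).ge) (volume_superlevel_ne_top hs one_pos))
    refine le_trans (le_of_eq ?_) (mul_le_mul_of_nonneg_left h hcoef.le)
    have hBn : (B ^ (1 / (n : ℝ))) ^ 2 = B / B ^ (((n : ℝ) - 2) / n) := by
      rw [← Real.rpow_natCast, ← Real.rpow_mul hBpos.le, eq_div_iff (by positivity),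
        ← Real.rpow_add hBpos]
      convert Real.rpow_one B using 2
      push_cast
      field_simp
      ring
    change _ = _ * ((n * B ^ (1 / (n : ℝ))) ^ 2 * _)
    rw [Real.div_rpow hpos.le hBpos.le, mul_pow, hBn, sphereArea, ← hB]
    have h2 : (n : ℝ) - 2 ≠ 0 := by linarith
    field_simp
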